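/- The functional $I$ satisfies the Palais–Smale condition: every sequence $(u_m)$ in $H$ such that $(I(u_m))$ is bounded and $DI(u_m)\to 0$ in the dual space $H^*$ has a subsequence that converges in the norm of $H$. (Condition (2) of the Ambrosetti–Rabinowitz theorem for $I$.) -/

import Mathlib

open MeasureTheory Filter Topology

theorem MeasureTheory.Lp.integral_abs_rpow_eq_norm_rpow {Ω : Type*} [MeasurableSpace Ω]
    {μ : Measure Ω} {p : ℝ} (hp : 0 < p) (f : Lp ℝ (ENNReal.ofReal p) μ) :
    ∫ x, |f x| ^ p ∂μ = ‖f‖ ^ p := by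
  have h0 : 0 ≤ ∫ x, |f x| ^ p ∂μ := integral_nonneg fun x => by positivity
  rw [Lp.norm_def, (Lp.memLp f).eLpNorm_eq_integral_rpow_norm (by simpa using hp) (by simp)]
  simp only [ENNReal.toReal_ofReal hp.le, Real.norm_eq_abs]
  rw [ENNReal.toReal_ofReal (by positivity), Real.rpow_inv_rpow h0 hp.ne']

/-- A function with a right-hand local minimum at `0` has nonnegative derivative there. -/
theorem HasDerivAt.nonneg_of_forall_pos_le {f : ℝ → ℝ} {f' : ℝ} (hf : HasDerivAt f f' 0)
    (h : ∀ t, 0 < t → f 0 ≤ f t) : 0 ≤ f' := by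
  refine ge_of_tendsto hf.tendsto_slope_zero_right ?_
  filter_upwards [self_mem_nhdsWithin] with t ht
  have ht : 0 < t := ht
  have := h t ht
  simp only [zero_add, smul_eq_mul]
  exact mul_nonneg (by positivity) (by linarith)

section NormRpow

variable {H E : Type*} [NormedAddCommGroup H] [NormedSpace ℝ H]
  [NormedAddCommGroup E] [NormedSpace ℝ E]

theorem HasFDerivAt.hasDerivAt_line {G : H → ℝ} {G' : H →L[ℝ] ℝ} {u : H}
    (hG : HasFDerivAt G G' u) (v : H) : HasDerivAt (fun t : ℝ => G (u + t • v)) (G' v) 0 := by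
  have hline : HasDerivAt (fun t : ℝ => u + t • v) v 0 := by
    simpa using ((hasDerivAt_id (0 : ℝ)).smul_const v).const_add u
  exact HasFDerivAt.comp_hasDerivAt (x := (0 : ℝ)) (l := G) (l' := G') (by simpa using hG) hline

/-- Euler's identity for the `p`-homogeneous function `‖T ·‖ ^ p / p`. -/
theorem HasFDerivAt.norm_rpow_comp_apply_self {p : ℝ} (hp : 1 ≤ p) {T : H →L[ℝ] E}
    {G' : H →L[ℝ] ℝ} {u : H} (hG : HasFDerivAt (fun w => 1 / p * ‖T w‖ ^ p) G' u) :
    G' u = ‖T u‖ ^ p := by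
  have hp0 : p ≠ 0 := by positivity
  have h1 := hG.hasDerivAt_line u
  have h2 : HasDerivAt (fun t : ℝ => 1 / p * ((1 + t) ^ p * ‖T u‖ ^ p)) (‖T u‖ ^ p) 0 := by
    have h := ((((hasDerivAt_id (0 : ℝ)).const_add 1).rpow_const (p := p)
      (Or.inr hp)).mul_const (‖T u‖ ^ p)).const_mul (1 / p)
    refine h.congr_deriv ?_
    simp [hp0]
  refine h1.unique (h2.congr_of_eventuallyEq ?_)
  filter_upwards [Ioi_mem_nhds (show (-1 : ℝ) < 0 by norm_num)] with t ht
  have ht : 0 ≤ 1 + t := by have : -1 < t := ht; linarith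
  have : T (u + t • u) = (1 + t) • T u := by simp [add_smul]
  rw [this, norm_smul, Real.norm_eq_abs, abs_of_nonneg ht, Real.mul_rpow ht (norm_nonneg _)]

theorem HasFDerivAt.norm_rpow_comp_apply_le {p : ℝ} (hp : 1 ≤ p) {T : H →L[ℝ] E}
    {G' : H →L[ℝ] ℝ} {u : H} (hG : HasFDerivAt (fun w => 1 / p * ‖T w‖ ^ p) G' u) (v : H) :
    G' v ≤ ‖T u‖ ^ (p - 1) * ‖T v‖ := by
  have hp0 : p ≠ 0 := by positivity
  have h1 := hG.hasDerivAt_line v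
  have h2 : HasDerivAt (fun t : ℝ => 1 / p * (‖T u‖ + t * ‖T v‖) ^ p)
      (‖T u‖ ^ (p - 1) * ‖T v‖) 0 := by
    have h := ((((hasDerivAt_id (0 : ℝ)).mul_const ‖T v‖).const_add ‖T u‖).rpow_const (p := p)
      (Or.inr hp)).const_mul (1 / p)
    refine h.congr_deriv ?_
    simp
    field_simp
  refine sub_nonneg.1 ((h2.sub h1).nonneg_of_forall_pos_le fun t ht => ?_)
  have hle : ‖T (u + t • v)‖ ≤ ‖T u‖ + t * ‖T v‖ := by
    rw [map_add, map_smul]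
    refine (norm_add_le _ _).trans_eq ?_
    rw [norm_smul, Real.norm_eq_abs, _root_.abs_of_pos ht]
  have := mul_le_mul_of_nonneg_left
    (Real.rpow_le_rpow (norm_nonneg _) hle (by positivity : 0 ≤ p)) (by positivity : 0 ≤ 1 / p)
  simpa using this

end NormRpow

theorem le_one_add_div_of_mul_sq_le {k c d x : ℝ} (hk : 0 < k) (hc : 0 ≤ c) (hd : 0 ≤ d)
    (h : k * x ^ 2 ≤ c + d * x) : x ≤ 1 + (c + d) / k := by
  rcases le_or_gt x 1 with hx | hx
  · have : 0 ≤ (c + d) / k := by positivity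
    linarith
  · have : x ≤ (c + d) / k := by
      rw [le_div_iff₀ hk]
      nlinarith
    linarith

/-- A bounded sequence has a subsequence whose image under a compact operator converges. -/
theorem IsCompactOperator.exists_subseq_tendsto {H E : Type*} [NormedAddCommGroup H]
    [NormedSpace ℝ H] [NormedAddCommGroup E] [NormedSpace ℝ E] {T : H →L[ℝ] E}
    (hT : IsCompactOperator T) {u : ℕ → H} {R : ℝ} (hu : ∀ m, ‖u m‖ ≤ R) :
    ∃ φ : ℕ → ℕ, StrictMono φ ∧ ∃ y, Tendsto (fun m => T (u (φ m))) atTop (𝓝 y) := by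
  obtain ⟨K, hK, hsub⟩ :=
    IsCompactOperator.image_closedBall_subset_compact (f := (T : H →ₗ[ℝ] E)) hT R
  obtain ⟨y, -, φ, hφ, hy⟩ := hK.tendsto_subseq (x := fun m => T (u m))
    fun m => hsub ⟨u m, by simpa using hu m, rfl⟩
  exact ⟨φ, hφ, y, hy⟩

/-- The abstract Yamabe-type functional
`I(u) = ½B(u,u) - (1/(q+1)) ∫ |Tu|^{q+1} dμ` satisfies the Palais–Smale condition:
every sequence `(u_m)` with `(I(u_m))` bounded and `DI(u_m) → 0` in `H*` has a
subsequence converging in the norm of `H`. -/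
theorem palais_smale_condition
    {H : Type*} [NormedAddCommGroup H] [InnerProductSpace ℝ H] [CompleteSpace H]
    {Ω : Type*} [MeasurableSpace Ω] (μ : Measure Ω)
    (q : ℝ) (hq : 1 < q) [Fact (1 ≤ ENNReal.ofReal (q + 1))]
    (T : H →L[ℝ] Lp ℝ (ENNReal.ofReal (q + 1)) μ)
    (hTcomp : IsCompactOperator T) (hTinj : Function.Injective T)
    (B : H →L[ℝ] H →L[ℝ] ℝ) (hBsymm : ∀ u v : H, B u v = B v u)
    (c0 : ℝ) (hc0 : 0 < c0) (hBcoer : ∀ u : H, c0 * ‖u‖ ^ 2 ≤ B u u)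
    (I : H → ℝ)
    (hI : ∀ u : H, I u = (1 / 2) * B u u - (1 / (q + 1)) * ∫ x, |(T u) x| ^ (q + 1) ∂μ)
    (DI : H → (H →L[ℝ] ℝ)) (hDI : ∀ u : H, HasFDerivAt I (DI u) u) :
    ∀ u : ℕ → H,
      (∃ C : ℝ, ∀ m : ℕ, |I (u m)| ≤ C) →
      Tendsto (fun m => DI (u m)) atTop (𝓝 0) →
      ∃ φ : ℕ → ℕ, StrictMono φ ∧ ∃ v : H, Tendsto (u ∘ φ) atTop (𝓝 v) := by
  rintro u ⟨C, hC⟩ hlim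
  have hInorm : ∀ w, I w = 1 / 2 * B w w - 1 / (q + 1) * ‖T w‖ ^ (q + 1) := fun w => by
    rw [hI, Lp.integral_abs_rpow_eq_norm_rpow (by linarith)]
  set p := q + 1
  have hp2 : 2 < p := by simp only [p]; linarith
  have hG : ∀ w, HasFDerivAt (fun w => 1 / p * ‖T w‖ ^ p) (B w - DI w) w := by
    intro w
    have hB : HasFDerivAt (fun w => 1 / 2 * B w w) (B w) w := by
      have h := ((B.hasFDerivAt (x := w)).clm_apply (hasFDerivAt_id w)).const_mul (1 / 2)
      refine h.congr_fderiv ?_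
      ext v
      simp [hBsymm v w]
      ring
    refine (hB.sub (hDI w)).congr_of_eventuallyEq (Eventually.of_forall fun x => ?_)
    simp only [Pi.sub_apply, hInorm]
    ring
  obtain ⟨D, hD⟩ : ∃ D, ∀ m, ‖DI (u m)‖ ≤ D := by
    obtain ⟨D, hD⟩ := hlim.norm.bddAbove_range
    exact ⟨D, fun m => hD ⟨m, rfl⟩⟩
  have hC0 : 0 ≤ C := (abs_nonneg _).trans (hC 0)
  have hD0 : 0 ≤ D := (norm_nonneg _).trans (hD 0)
  have hk : 0 < (1 / 2 - 1 / p) * c0 :=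
    mul_pos (sub_pos.2 (one_div_lt_one_div_of_lt two_pos hp2)) hc0
  obtain ⟨R, hR⟩ : ∃ R, ∀ m, ‖u m‖ ≤ R := by
    refine ⟨_, fun m => le_one_add_div_of_mul_sq_le hk hC0 hD0 ?_⟩
    have heuler := (hG (u m)).norm_rpow_comp_apply_self (by linarith)
    rw [_root_.sub_apply] at heuler
    have hIm := hInorm (u m)
    rw [← heuler] at hIm
    have hDu : |DI (u m) (u m)| ≤ D * ‖u m‖ :=
      (DI (u m)).le_of_opNorm_le (hD m) (u m)
    have hp1 : 1 / p ≤ 1 := by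
      rw [div_le_one (by linarith)]
      linarith
    have hDp : 1 / p * -DI (u m) (u m) ≤ D * ‖u m‖ := by
      refine (mul_le_mul_of_nonneg_left ((neg_le_abs _).trans hDu) (by positivity)).trans ?_
      exact mul_le_of_le_one_left (by positivity) hp1
    have hBu := mul_le_mul_of_nonneg_left (hBcoer (u m)) (pos_of_mul_pos_left hk hc0.le).le
    have hIu := (le_abs_self _).trans (hC m)
    nlinarith
  obtain ⟨φ, hφ, y, hy⟩ := hTcomp.exists_subseq_tendsto hR
  refine ⟨φ, hφ, cauchySeq_tendsto_of_complete ?_⟩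
  have hR0 : 0 ≤ R := (norm_nonneg _).trans (hR 0)
  set L := (‖T‖ * R) ^ (p - 1)
  have hGle : ∀ m v, (B (u m) - DI (u m)) v ≤ L * ‖T v‖ := fun m v =>
    ((hG (u m)).norm_rpow_comp_apply_le (by linarith) v).trans <|
      mul_le_mul_of_nonneg_right (Real.rpow_le_rpow (norm_nonneg _)
        (T.le_opNorm_of_le (hR m)) (by linarith)) (norm_nonneg _)
  have key : ∀ m n, ‖u m - u n‖ ^ 2 ≤
      (2 * R * (‖DI (u m)‖ + ‖DI (u n)‖) + 2 * L * ‖T (u m) - T (u n)‖) / c0 := by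
    intro m n
    rw [le_div_iff₀ hc0]
    have h1 := hBcoer (u m - u n)
    have h2 := hGle m (u m - u n)
    have h3 := hGle n (u n - u m)
    have hw : ‖u m - u n‖ ≤ 2 * R := by
      linarith [norm_sub_le (u m) (u n), hR m, hR n]
    have h4 := (le_abs_self _).trans ((DI (u m)).le_opNorm_of_le hw)
    have h5 := (le_abs_self _).trans ((DI (u n)).le_opNorm_of_le (norm_sub_rev (u m) (u n) ▸ hw))
    rw [map_sub T (u n), norm_sub_rev] at h3
    simp only [map_sub, _root_.sub_apply] at h1 h2 h3 h4 h5
    linarith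
  have hDφ : Tendsto (fun m => ‖DI (u (φ m))‖) atTop (𝓝 0) := by
    simpa using (hlim.comp hφ.tendsto_atTop).norm
  have hb : Tendsto (fun x : ℕ × ℕ => (2 * R * (‖DI (u (φ x.1))‖ + ‖DI (u (φ x.2))‖) +
      2 * L * ‖T (u (φ x.1)) - T (u (φ x.2))‖) / c0) atTop (𝓝 0) := by
    rw [← prod_atTop_atTop_eq]
    have h1 := (hDφ.comp tendsto_fst).add (hDφ.comp (tendsto_snd (f := atTop (α := ℕ))))
    have h2 := ((hy.comp tendsto_fst).sub (hy.comp (tendsto_snd (f := atTop (α := ℕ))))).norm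
    simpa using ((h1.const_mul (2 * R)).add (h2.const_mul (2 * L))).div_const c0
  rw [cauchySeq_iff_tendsto_dist_atTop_0]
  refine squeeze_zero (fun _ => dist_nonneg) (fun x => ?_) (by simpa using hb.sqrt)
  rw [dist_eq_norm]
  exact Real.le_sqrt_of_sq_le (key _ _)
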